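/- There exists a constant C > 0 such that for every finite connected simple graph G on n vertices and every real α with n−1 < α < n(n−1), every Nash equilibrium S of the SUM-game and every nonempty profile S* satisfy c(S) ≤ C·√α·c(S*); i.e., the price of anarchy in this range is O(√α). -/

import Mathlib

open Finset

/-- Distance from a node `u` to the gateway set `S` (hop distance to nearest gateway). -/
noncomputable def gwDist {V : Type*} (G : SimpleGraph V) (S : Finset V) (u : V) : ℕ :=
  sInf ((fun s => G.dist u s) '' (S : Set V))

/-- Communication distance `δ_S(u,v) = min{d(u,v), d(u,S) + d(S,v)}`. -/
noncomputable def comDist {V : Type*} (G : SimpleGraph V) (S : Finset V) (u v : V) : ℕ :=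
  min (G.dist u v) (gwDist G S u + gwDist G S v)

/-- Private cost of node `v` in the SUM-game. -/
noncomputable def sumCost {V : Type*} [Fintype V] [DecidableEq V]
    (G : SimpleGraph V) (α : ℝ) (S : Finset V) (v : V) : ℝ :=
  (if v ∈ S then α else 0) + ∑ u : V, (comDist G S v u : ℝ)

/-- Social cost of the SUM-game. -/
noncomputable def sumSocial {V : Type*} [Fintype V] [DecidableEq V]
    (G : SimpleGraph V) (α : ℝ) (S : Finset V) : ℝ :=
  ∑ v : V, sumCost G α S v

/-- `v` performs an improving response changing profile `S` into `S'` in the SUM-game. -/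
def SumIRBy {V : Type*} [Fintype V] [DecidableEq V]
    (G : SimpleGraph V) (α : ℝ) (v : V) (S S' : Finset V) : Prop :=
  ((v ∉ S ∧ S' = insert v S) ∨ (v ∈ S ∧ S' = S.erase v ∧ (S.erase v).Nonempty)) ∧
    sumCost G α S' v < sumCost G α S v

/-- `S'` arises from `S` by an improving response in the SUM-game. -/
def SumIR {V : Type*} [Fintype V] [DecidableEq V]
    (G : SimpleGraph V) (α : ℝ) (S S' : Finset V) : Prop :=
  ∃ v, SumIRBy G α v S S'

/-- `S` is a Nash equilibrium of the SUM-game: no node has an improving response. -/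
def SumNash {V : Type*} [Fintype V] [DecidableEq V]
    (G : SimpleGraph V) (α : ℝ) (S : Finset V) : Prop :=
  ∀ S', ¬ SumIR G α S S'

theorem gwDist_le_dist {V : Type*} (G : SimpleGraph V) {S : Finset V} (u : V) {s : V}
    (hs : s ∈ S) : gwDist G S u ≤ G.dist u s :=
  Nat.sInf_le ⟨s, hs, rfl⟩

theorem exists_gwDist_eq_dist {V : Type*} (G : SimpleGraph V) {S : Finset V} (hS : S.Nonempty)
    (u : V) : ∃ s ∈ S, gwDist G S u = G.dist u s := by
  obtain ⟨t, ht⟩ := hS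
  obtain ⟨s, hs, h⟩ := Nat.sInf_mem (s := (fun s => G.dist u s) '' (S : Set V)) ⟨_, t, ht, rfl⟩
  exact ⟨s, hs, h.symm⟩

theorem gwDist_eq_zero_of_mem {V : Type*} (G : SimpleGraph V) {S : Finset V} {v : V}
    (hv : v ∈ S) : gwDist G S v = 0 :=
  Nat.le_zero.mp ((gwDist_le_dist G v hv).trans SimpleGraph.dist_self.le)

theorem gwDist_anti {V : Type*} (G : SimpleGraph V) {S T : Finset V} (hS : S.Nonempty)
    (hST : S ⊆ T) (u : V) : gwDist G T u ≤ gwDist G S u := by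
  obtain ⟨s, hs, h⟩ := exists_gwDist_eq_dist G hS u
  exact h ▸ gwDist_le_dist G u (hST hs)

theorem comDist_anti {V : Type*} (G : SimpleGraph V) {S T : Finset V} (hS : S.Nonempty)
    (hST : S ⊆ T) (u v : V) : comDist G T u v ≤ comDist G S u v :=
  min_le_min le_rfl (add_le_add (gwDist_anti G hS hST u) (gwDist_anti G hS hST v))

/-- A vertex at each intermediate distance on a shortest path. -/
theorem exists_dist_eq_of_le_dist {V : Type*} {G : SimpleGraph V} (hG : G.Connected) {v s : V}
    {i : ℕ} (hi : i ≤ G.dist v s) : ∃ x, G.dist v x = i ∧ G.dist x s = G.dist v s - i := by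
  obtain ⟨p, hp⟩ := hG.exists_walk_length_eq_dist v s
  have h1 : G.dist v (p.getVert i) ≤ i :=
    (SimpleGraph.dist_le (p.take i)).trans (by simp [SimpleGraph.Walk.take_length])
  have h2 : G.dist (p.getVert i) s ≤ G.dist v s - i :=
    (SimpleGraph.dist_le (p.drop i)).trans (by simp [SimpleGraph.Walk.drop_length, hp])
  have h3 : G.dist v s ≤ G.dist v (p.getVert i) + G.dist (p.getVert i) s := hG.dist_triangle
  exact ⟨p.getVert i, by omega, by omega⟩

/-- At a Nash equilibrium, every node is within `√(8α)` of the gateways. -/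
theorem gwDist_sq_le_of_sumNash {V : Type*} [Fintype V] [DecidableEq V] {G : SimpleGraph V}
    (hG : G.Connected) {α : ℝ} (hα : 0 ≤ α) {S : Finset V} (hS : S.Nonempty)
    (hN : SumNash G α S) (v : V) : (gwDist G S v : ℝ) ^ 2 ≤ 8 * α := by
  by_cases hv : v ∈ S
  · rw [gwDist_eq_zero_of_mem G hv]
    simpa using hα
  obtain ⟨s, hs, hD⟩ := exists_gwDist_eq_dist G hS v
  have hopen : ∑ u, (comDist G S v u : ℝ) ≤ α + ∑ u, (comDist G (insert v S) v u : ℝ) := by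
    have h := hN (insert v S)
    contrapose! h
    exact ⟨v, Or.inl ⟨hv, rfl⟩, by simpa [sumCost, hv] using h⟩
  set D := gwDist G S v
  have hex : ∀ j : ℕ, ∃ x, j ≤ D → G.dist v x = D - j ∧ G.dist x s = j := by
    intro j
    by_cases hj : j ≤ D
    · obtain ⟨x, hx1, hx2⟩ := exists_dist_eq_of_le_dist hG (v := v) (s := s) (i := D - j) (by omega)
      exact ⟨x, fun _ => ⟨hx1, by omega⟩⟩
    · exact ⟨v, fun h => absurd h hj⟩
  choose p hp using hex
  have hgain : ∀ j ∈ range (D / 4 + 1),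
      (D : ℝ) / 2 ≤ comDist G S v (p j) - comDist G (insert v S) v (p j) := by
    intro j hj
    rw [mem_range] at hj
    obtain ⟨h1, h2⟩ := hp j (by omega)
    have h3 : D - j ≤ comDist G S v (p j) := le_min h1.ge (by omega)
    have h4 : comDist G (insert v S) v (p j) ≤ j := by
      have h5 := gwDist_eq_zero_of_mem G (mem_insert_self v S)
      have h6 := gwDist_le_dist G (p j) (mem_insert_of_mem (b := v) hs)
      exact (min_le_right _ _).trans (by omega)
    have h7 : D + 2 * comDist G (insert v S) v (p j) ≤ 2 * comDist G S v (p j) := by omega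
    have h8 : (D : ℝ) + 2 * comDist G (insert v S) v (p j) ≤ 2 * comDist G S v (p j) := by
      exact_mod_cast h7
    linarith
  have hinj : Set.InjOn p (range (D / 4 + 1)) := by
    intro i hi j hj hij
    simp only [coe_range, Set.mem_Iio] at hi hj
    rw [← (hp i (by omega)).2, ← (hp j (by omega)).2, hij]
  have hsum : ((D / 4 + 1 : ℕ) : ℝ) * ((D : ℝ) / 2) ≤ α := by
    calc ((D / 4 + 1 : ℕ) : ℝ) * ((D : ℝ) / 2)
        = ∑ _j ∈ range (D / 4 + 1), (D : ℝ) / 2 := by simp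
      _ ≤ ∑ j ∈ range (D / 4 + 1),
            ((comDist G S v (p j) : ℝ) - comDist G (insert v S) v (p j)) := sum_le_sum hgain
      _ = ∑ u ∈ (range (D / 4 + 1)).image p,
            ((comDist G S v u : ℝ) - comDist G (insert v S) v u) :=
          (sum_image (f := fun u => (comDist G S v u : ℝ) - comDist G (insert v S) v u) hinj).symm
      _ ≤ ∑ u, ((comDist G S v u : ℝ) - comDist G (insert v S) v u) :=
          sum_le_sum_of_subset_of_nonneg (subset_univ _) fun u _ _ =>
            sub_nonneg.mpr (Nat.cast_le.mpr (comDist_anti G hS (subset_insert v S) v u))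
      _ ≤ α := by
          rw [sum_sub_distrib]
          linarith
  have hdiv : (D : ℝ) ≤ 4 * ((D / 4 + 1 : ℕ) : ℝ) := by
    have : D ≤ 4 * (D / 4 + 1) := by omega
    exact_mod_cast this
  nlinarith [(Nat.cast_nonneg D : (0 : ℝ) ≤ D)]

theorem one_le_comDist {V : Type*} {G : SimpleGraph V} (hG : G.Connected) {S : Finset V}
    (hS : S.Nonempty) {v u : V} (hv : v ∉ S) (hu : u ≠ v) : 1 ≤ comDist G S v u := by
  obtain ⟨s, hs, h⟩ := exists_gwDist_eq_dist G hS v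
  have hvs : 0 < G.dist v s := hG.pos_dist_of_ne fun h => hv (h ▸ hs)
  exact le_min (hG.pos_dist_of_ne hu.symm) (by omega)

theorem card_sub_one_le_sumCost {V : Type*} [Fintype V] [DecidableEq V] {G : SimpleGraph V}
    (hG : G.Connected) {α : ℝ} (hα : (Fintype.card V : ℝ) - 1 ≤ α) {S : Finset V}
    (hS : S.Nonempty) (v : V) : (Fintype.card V : ℝ) - 1 ≤ sumCost G α S v := by
  unfold sumCost
  split_ifs with hv
  · have : (0 : ℝ) ≤ ∑ u, (comDist G S v u : ℝ) := sum_nonneg fun u _ => Nat.cast_nonneg _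
    linarith
  · rw [zero_add]
    calc (Fintype.card V : ℝ) - 1 = ∑ u : V, ((1 : ℝ) - if u = v then 1 else 0) := by
          simp [sum_sub_distrib]
      _ ≤ ∑ u, (comDist G S v u : ℝ) := by
          refine sum_le_sum fun u _ => ?_
          split_ifs with hu
          · simp
          · simpa using one_le_comDist hG hS hv hu

theorem sumSocial_lower_bound {V : Type*} [Fintype V] [DecidableEq V] {G : SimpleGraph V}
    (hG : G.Connected) {α : ℝ} (hα : (Fintype.card V : ℝ) - 1 ≤ α) {S : Finset V}
    (hS : S.Nonempty) :
    (Fintype.card V : ℝ) * ((Fintype.card V : ℝ) - 1) ≤ sumSocial G α S := by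
  simpa [sumSocial] using card_nsmul_le_sum univ (sumCost G α S) _
    fun v _ => card_sub_one_le_sumCost hG hα hS v

theorem sumSocial_upper_bound_of_sumNash {V : Type*} [Fintype V] [DecidableEq V]
    {G : SimpleGraph V} (hG : G.Connected) {α : ℝ} (hα : 0 ≤ α)
    (hαn : α ≤ (Fintype.card V : ℝ) ^ 2) {S : Finset V} (hS : S.Nonempty)
    (hN : SumNash G α S) :
    sumSocial G α S ≤ 7 * √α * (Fintype.card V : ℝ) ^ 2 := by
  have hgw : ∀ v, (gwDist G S v : ℝ) ≤ 3 * √α := fun v =>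
    abs_le_of_sq_le_sq' (by
      rw [mul_pow, Real.sq_sqrt hα]
      linarith [gwDist_sq_le_of_sumNash hG hα hS hN v]) (by positivity) |>.2
  have hcom : ∀ v u, (comDist G S v u : ℝ) ≤ 6 * √α := by
    intro v u
    have h : (comDist G S v u : ℝ) ≤ gwDist G S v + gwDist G S u := by
      exact_mod_cast min_le_right _ _
    linarith [hgw v, hgw u]
  have hαsqrt : α ≤ √α * Fintype.card V := by
    have h : √α ≤ Fintype.card V := Real.sqrt_le_iff.mpr ⟨by positivity, hαn⟩
    nlinarith [Real.mul_self_sqrt hα, Real.sqrt_nonneg α]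
  have hcost : ∀ v, sumCost G α S v ≤ 7 * √α * Fintype.card V := by
    intro v
    have h1 : (if v ∈ S then α else 0) ≤ α := by split_ifs <;> simp [hα]
    have h2 : ∑ u, (comDist G S v u : ℝ) ≤ Fintype.card V * (6 * √α) := by
      simpa using sum_le_card_nsmul univ _ _ fun u _ => hcom v u
    unfold sumCost
    linarith
  have h : sumSocial G α S ≤ Fintype.card V * (7 * √α * Fintype.card V) := by
    simpa [sumSocial] using sum_le_card_nsmul univ (sumCost G α S) _ fun v _ => hcost v
  linarith

/-- There is a constant C > 0 such that for every connected graph on n vertices and every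
α with n−1 < α < n(n−1), every Nash equilibrium S and every nonempty profile S* of the
SUM-game satisfy c(S) ≤ C·√α·c(S*): the price of anarchy in this range is O(√α). -/
theorem stmt_15 :
    ∃ C : ℝ, 0 < C ∧
      ∀ (V : Type) [Fintype V] [DecidableEq V] (G : SimpleGraph V), G.Connected →
        ∀ α : ℝ, (Fintype.card V : ℝ) - 1 < α →
          α < (Fintype.card V : ℝ) * ((Fintype.card V : ℝ) - 1) →
          ∀ S : Finset V, S.Nonempty → SumNash G α S →
            ∀ S' : Finset V, S'.Nonempty →
              sumSocial G α S ≤ C * Real.sqrt α * sumSocial G α S' := by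
  refine ⟨14, by norm_num, ?_⟩
  intro V _ _ G hG α hα1 hα2 S hS hN S' hS'
  have hn1 : (1 : ℝ) ≤ Fintype.card V := by
    have := hG.nonempty
    exact_mod_cast Fintype.card_pos (α := V)
  have hn2 : (2 : ℝ) ≤ Fintype.card V := by
    have h : (1 : ℝ) < Fintype.card V := by
      by_contra! h
      nlinarith
    exact_mod_cast h
  have hlow := sumSocial_lower_bound hG hα1.le hS'
  have hup := sumSocial_upper_bound_of_sumNash hG (by linarith) (by nlinarith) hS hN
  calc sumSocial G α S ≤ 7 * √α * (Fintype.card V : ℝ) ^ 2 := hup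
    _ ≤ 7 * √α * (2 * sumSocial G α S') := by
        gcongr
        nlinarith
    _ = 14 * √α * sumSocial G α S' := by ring
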